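/- Let B(F) be a stationary generalized Bratteli diagram whose vertex levels are identified with ℤ and whose incidence matrix F = (f_{vw})_{v,w∈ℤ} is irreducible and aperiodic. Then the tail equivalence relation R on the path space X_B is topologically transitive: there exists x∈X_B whose tail equivalence class {y∈X_B : y R x} is dense in X_B. -/

import Mathlib

open scoped ENNReal NNReal
open Filter
open scoped Classical

noncomputable section

/-- Powers of a countably infinite nonnegative matrix, computed in `ℝ≥0∞`:
`matPow A n i j` is the `(i, j)` entry of `A ^ n`. -/
noncomputable def matPow {ι : Type} (A : ι → ι → ℝ≥0∞) : ℕ → ι → ι → ℝ≥0∞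
  | 0 => fun i j => if i = j then 1 else 0
  | n + 1 => fun i j => ∑' k : ι, matPow A n i k * A k j

/-- `A` is irreducible: for every pair of indices `i, j` there is `n ≥ 1` with
`(A ^ n)_{i j} > 0`. -/
def MatIrreducible {ι : Type} (A : ι → ι → ℝ≥0∞) : Prop :=
  ∀ i j : ι, ∃ n : ℕ, 0 < n ∧ matPow A n i j ≠ 0

/-- `A` is aperiodic: for every index `i`, the gcd of `{n ≥ 1 : (A ^ n)_{i i} > 0}`
is `1`, i.e. the only common divisor of that set is `1`. -/
def MatAperiodic {ι : Type} (A : ι → ι → ℝ≥0∞) : Prop :=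
  ∀ i : ι, ∀ d : ℕ, (∀ n : ℕ, 0 < n → matPow A n i i ≠ 0 → d ∣ n) → d = 1

/-- `lam` is the Perron eigenvalue of `A`: `lam = lim_n ((A ^ n)_{i i})^{1/n}`
(independently of `i`). -/
def IsPerronValue {ι : Type} (A : ι → ι → ℝ≥0∞) (lam : ℝ≥0∞) : Prop :=
  ∀ i : ι, Tendsto (fun n : ℕ => matPow A n i i ^ ((n : ℝ)⁻¹)) atTop (nhds lam)

/-- `A` (with Perron value `lam`) is recurrent: `∑_n (A ^ n)_{i i} / lam ^ n = ∞`. -/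
def MatRecurrent {ι : Type} (A : ι → ι → ℝ≥0∞) (lam : ℝ≥0∞) : Prop :=
  ∀ i : ι, ∑' n : ℕ, matPow A n i i * (lam⁻¹) ^ n = ⊤

/-- The first-return counts: `lcount A n w v` is the quantity `l_{w v}(n)` defined by
`l_{w v}(1) = a_{w v}` and `l_{w v}(n+1) = ∑_{i ≠ w} l_{w i}(n) a_{i v}`. -/
noncomputable def lcount {ι : Type} (A : ι → ι → ℝ≥0∞) : ℕ → ι → ι → ℝ≥0∞
  | 0 => fun _ _ => 0
  | 1 => A
  | n + 2 => fun w v => ∑' i : ι, if i = w then 0 else lcount A (n + 1) w i * A i v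

/-- `A` (with Perron value `lam`) is positive recurrent: it is recurrent and
`∑_n n · l_{w w}(n) · lam ^ {-n} < ∞`. -/
def MatPosRecurrent {ι : Type} (A : ι → ι → ℝ≥0∞) (lam : ℝ≥0∞) : Prop :=
  MatRecurrent A lam ∧
    ∀ w : ι, ∑' n : ℕ, (n : ℝ≥0∞) * lcount A n w w * (lam⁻¹) ^ n ≠ ⊤

end

open Set MeasureTheory

/-- A stationary generalized Bratteli diagram with vertex levels identified with `ℤ`:
the same countable edge set `E` (with source and range maps `s, r : E → ℤ`) connects
every pair of consecutive levels. -/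
structure StatGBD where
  /-- the set of edges between any two consecutive levels -/
  E : Type
  countE : Countable E
  src : E → ℤ
  rng : E → ℤ
  src_surj : ∀ v : ℤ, ∃ e : E, src e = v
  rng_surj : ∀ v : ℤ, ∃ e : E, rng e = v
  rng_fin : ∀ v : ℤ, {e : E | rng e = v}.Finite

namespace StatGBD

variable (B : StatGBD)

/-- The path space `X_B`: infinite sequences of composable edges. -/
def Path := { x : ℕ → B.E // ∀ n, B.src (x (n + 1)) = B.rng (x n) }

/-- The topology on the path space, generated by cylinder sets: the topology induced
from the product of the discrete topologies on the edge set. -/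
instance : TopologicalSpace B.Path :=
  TopologicalSpace.induced (fun x : B.Path => x.1)
    (@Pi.topologicalSpace ℕ (fun _ => B.E) (fun _ => ⊥))

/-- The Borel σ-algebra on the path space. -/
instance : MeasurableSpace B.Path := borel B.Path

/-- A finite path from level `0` to level `n + 1` (a sequence of `n + 1` composable
edges). -/
def FinPath (n : ℕ) :=
  { p : Fin (n + 1) → B.E // ∀ i : Fin n, B.src (p i.succ) = B.rng (p i.castSucc) }

/-- The range of a finite path: a vertex of level `n + 1`. -/
def FinPath.out {n : ℕ} (p : B.FinPath n) : ℤ := B.rng (p.1 (Fin.last n))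

/-- The cylinder set of a finite path. -/
def cyl {n : ℕ} (p : B.FinPath n) : Set B.Path :=
  { x : B.Path | ∀ i : Fin (n + 1), x.1 i.1 = p.1 i }

/-- Two infinite paths are tail equivalent if they eventually agree. -/
def TailEquiv (x y : B.Path) : Prop := ∃ N : ℕ, ∀ n, N ≤ n → x.1 n = y.1 n

/-- The incidence matrix of the stationary diagram: `Fmat B v w` is the number of edges
from the vertex `w` of one level to the vertex `v` of the next level (i.e. `f_{v w}`),
viewed in `ℝ≥0∞`. -/
noncomputable def Fmat : ℤ → ℤ → ℝ≥0∞ :=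
  fun v w => (Nat.card {e : B.E // B.src e = w ∧ B.rng e = v} : ℝ≥0∞)

/-- The transpose `A = Fᵀ` of the incidence matrix: `Amat B w v = a_{w v} = f_{v w}`
is the number of edges from `w` to `v`, viewed in `ℝ≥0∞`. -/
noncomputable def Amat : ℤ → ℤ → ℝ≥0∞ :=
  fun w v => (Nat.card {e : B.E // B.src e = w ∧ B.rng e = v} : ℝ≥0∞)

end StatGBD

namespace StatGBD

/-- There is a walk of length `n` from `w` to `v`. -/
def Walk (B : StatGBD) : ℕ → ℤ → ℤ → Prop
  | 0 => fun w v => w = v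
  | n + 1 => fun w v => ∃ e : B.E, B.src e = w ∧ Walk B n (B.rng e) v

theorem walk_of_matPow (B : StatGBD) (n : ℕ) (v w : ℤ)
    (h : matPow B.Fmat n v w ≠ 0) : B.Walk n w v := by
  induction n generalizing w with
  | zero =>
    simp only [matPow] at h
    by_contra hne
    exact h (if_neg fun h' => hne h'.symm)
  | succ n ih =>
    simp only [matPow] at h
    have : ∃ k, matPow B.Fmat n v k * B.Fmat k w ≠ 0 := by
      by_contra hcon
      push Not at hcon
      exact h (ENNReal.tsum_eq_zero.2 hcon)
    obtain ⟨k, hk⟩ := this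
    have h1 := left_ne_zero_of_mul hk
    have h2 := right_ne_zero_of_mul hk
    have h3 : Nat.card {e : B.E // B.src e = w ∧ B.rng e = k} ≠ 0 := by
      intro h0
      apply h2
      simp only [Fmat, h0, Nat.cast_zero]
    obtain ⟨⟨e, he1, he2⟩⟩ := (Nat.card_ne_zero.1 h3).1
    exact ⟨e, he1, he2 ▸ ih k h1⟩

theorem Walk.trans (B : StatGBD) {a b : ℕ} {u v w : ℤ} (h1 : B.Walk a u v)
    (h2 : B.Walk b v w) : B.Walk (a + b) u w := by
  induction a generalizing u with
  | zero =>
    have h1 : u = v := h1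
    subst h1
    rwa [Nat.zero_add]
  | succ n ih =>
    obtain ⟨e, he, h⟩ := h1
    rw [Nat.add_right_comm]
    exact ⟨e, he, ih h⟩

theorem Walk.glue (B : StatGBD) {n : ℕ} {w v : ℤ} (h : B.Walk n w v) (y : B.Path)
    (hy : B.src (y.1 0) = v) :
    ∃ z : B.Path, B.src (z.1 0) = w ∧ ∀ k, z.1 (n + k) = y.1 k := by
  induction n generalizing w with
  | zero =>
    have h : w = v := h
    exact ⟨y, hy.trans h.symm, fun k => by rw [Nat.zero_add]⟩
  | succ n ih =>
    obtain ⟨e, he, h⟩ := h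
    obtain ⟨z, hz, hk⟩ := ih h
    refine ⟨⟨fun i => Nat.casesOn i e z.1, ?_⟩, he, ?_⟩
    · intro i
      cases i with
      | zero => exact hz
      | succ i => exact z.2 i
    · intro k
      rw [Nat.add_right_comm]
      exact hk k

theorem exists_path (B : StatGBD) (v : ℤ) : ∃ y : B.Path, B.src (y.1 0) = v := by
  choose g hg using B.src_surj
  refine ⟨⟨fun n => Nat.rec (g v) (fun _ e => g (B.rng e)) n, ?_⟩, hg v⟩
  intro n
  exact hg _

theorem exists_periodic (B : StatGBD) {l : ℕ} (hl : 0 < l) {v : ℤ} (h : B.Walk l v v) :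
    ∃ x : B.Path, ∀ k, B.src (x.1 (k * l)) = v := by
  obtain ⟨y, hy⟩ := B.exists_path v
  obtain ⟨z, hz, hk⟩ := h.glue B y hy
  have hzl : B.src (z.1 l) = v := by
    have := hk 0
    rw [Nat.add_zero] at this
    rw [this, hy]
  refine ⟨⟨fun n => z.1 (n % l), ?_⟩, ?_⟩
  · intro n
    have hlt := Nat.mod_lt n hl
    rcases Nat.lt_or_ge (n % l + 1) l with h1 | h1
    · have : (n + 1) % l = n % l + 1 := by
        rw [Nat.add_mod, Nat.add_mod_mod, Nat.mod_eq_of_lt h1]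
      simp only [this]
      exact z.2 _
    · have h2 : n % l + 1 = l := by omega
      have : (n + 1) % l = 0 := by
        rw [← Nat.mod_add_mod, h2, Nat.mod_self]
      simp only [this]
      rw [hz, ← z.2, h2, hzl]
  · intro k
    simp only [Nat.mul_mod_left]
    exact hz

theorem eventually_walk (B : StatGBD) (haper : MatAperiodic B.Fmat) (v : ℤ) :
    ∃ N, ∀ m ≥ N, B.Walk m v v := by
  let S : AddSubmonoid ℕ :=
    { carrier := {n | B.Walk n v v}
      zero_mem' := rfl
      add_mem' := fun ha hb => Walk.trans B ha hb }
  have hg : Nat.setGcd (S : Set ℕ) = 1 :=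
    haper v _ fun n _ hn => Nat.setGcd_dvd_of_mem (walk_of_matPow B n v v hn)
  obtain ⟨N, hN⟩ := Nat.exists_mem_closure_of_ge (S : Set ℕ)
  refine ⟨N, fun m hm => ?_⟩
  have := hN m hm (by rw [hg]; exact one_dvd _)
  rw [AddSubmonoid.closure_eq] at this
  exact this

theorem exists_cyl (B : StatGBD) (U : Set B.Path) (hU : IsOpen U) (y : B.Path) (hy : y ∈ U) :
    ∃ m : ℕ, ∀ z : B.Path, (∀ i < m, z.1 i = y.1 i) → z ∈ U := by
  letI : TopologicalSpace B.E := ⊥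
  obtain ⟨V, hV, rfl⟩ := isOpen_induced_iff.1 hU
  obtain ⟨I, u, hu, hI⟩ := isOpen_pi_iff.1 hV y.1 hy
  refine ⟨I.sup id + 1, fun z hz => hI fun a ha => ?_⟩
  have h1 := hz a (Nat.lt_succ_of_le (Finset.le_sup (f := id) ha))
  have h2 := (hu a ha).2
  rw [← h1] at h2
  exact h2

end StatGBD

/-- Let `B(F)` be a stationary generalized Bratteli diagram with vertex
levels identified with `ℤ` whose incidence matrix `F` is irreducible and aperiodic.
Then the tail equivalence relation on the path space is topologically transitive: there
is a path whose tail equivalence class is dense. -/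
theorem tail_equivalence_topologically_transitive (B : StatGBD)
    (hirr : MatIrreducible B.Fmat) (haper : MatAperiodic B.Fmat) :
    ∃ x : B.Path, Dense {y : B.Path | B.TailEquiv x y} := by
  obtain ⟨l, hl, hll⟩ := hirr 0 0
  obtain ⟨x, hx⟩ := B.exists_periodic hl (B.walk_of_matPow _ _ _ hll)
  refine ⟨x, dense_iff_inter_open.2 ?_⟩
  rintro U hU ⟨y, hy⟩
  obtain ⟨m, hm⟩ := B.exists_cyl U hU y hy
  obtain ⟨a, -, ha⟩ := hirr 0 (B.src (y.1 m))
  have ha' := B.walk_of_matPow _ _ _ ha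
  obtain ⟨N, hN⟩ := B.eventually_walk haper 0
  set k := m + a + N with hk
  have hkl : k ≤ k * l := Nat.le_mul_of_pos_right k hl
  have hw := ha'.trans B (hN (k * l - m - a) (by omega))
  obtain ⟨t, ht0, ht⟩ := hw.glue B ⟨fun n => x.1 (k * l + n), fun n => x.2 _⟩ (hx k)
  have hsp : ∀ n, B.src ((fun i => if i < m then y.1 i else t.1 (i - m)) (n + 1)) =
      B.rng ((fun i => if i < m then y.1 i else t.1 (i - m)) n) := by
    intro n
    rcases Nat.lt_trichotomy (n + 1) m with h | h | h
    · simp only [h, if_true, show n < m by omega]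
      exact y.2 n
    · subst h
      simp only [lt_irrefl, if_false, Nat.sub_self, Nat.lt_succ_self, if_true]
      rw [ht0]
      exact y.2 n
    · simp only [show ¬ (n + 1 < m) by omega, show ¬ (n < m) by omega, if_false,
        show n + 1 - m = n - m + 1 by omega]
      exact t.2 _
  let q : B.Path := ⟨fun i => if i < m then y.1 i else t.1 (i - m), hsp⟩
  refine ⟨q, hm q fun i hi => if_pos hi, k * l, fun n hn => ?_⟩
  have h1 := ht (n - k * l)
  have h2 : q.1 n = t.1 (n - m) := if_neg (by omega)
  rw [h2]
  rw [show a + (k * l - m - a) + (n - k * l) = n - m by omega] at h1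
  rw [h1]
  simp only [show k * l + (n - k * l) = n by omega]
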